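/- arXiv:math/0102096 — 2 statements merged into one kernel-verified Lean document; each statement's English description precedes it below -/
import Mathlib

section
/- There exist homogeneous polynomials a₃ of degree 3 and b₄ of degree 4 in ℂ[x₁,x₂,x₃,x₄] such that the sextic polynomial x₁x₂b₄ − a₃² does not vanish identically on any 2-dimensional linear subspace of ℂ⁴; equivalently, the discriminant surface {x₁x₂b₄ − a₃² = 0} ⊂ ℙ³ of the 2-to-1 projection of the quartic X₄ from its singular point contains no lines. (The paper asserts this holds for a general choice of a₃, b₄.) -/
open MvPolynomial

/-- A linear functional on a space of dimension at least two has a nonzero zero. -/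
theorem Submodule.exists_mem_ne_zero_apply_eq_zero {K V : Type*} [Field K] [AddCommGroup V]
    [Module K V] (W : Submodule K V) (hW : Module.finrank K W = 2) (f : V →ₗ[K] K) :
    ∃ v ∈ W, v ≠ 0 ∧ f v = 0 := by
  have : FiniteDimensional K W := Module.finite_of_finrank_eq_succ hW
  have hker : (f.comp W.subtype).ker ≠ ⊥ :=
    LinearMap.ker_ne_bot_of_finrank_lt (by rw [hW, Module.finrank_self]; norm_num)
  obtain ⟨v, hv, hv0⟩ := Submodule.exists_mem_ne_zero_of_ne_bot hker
  exact ⟨v, v.2, by simpa using hv0, hv⟩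

/-- The values of the sextic `x₁x₂(x₁⁴ + x₂x₄³) - (x₃³ + (x₁ + x₂)x₄²)²`. -/
def sextic (x y z w : ℂ) : ℂ :=
  x * y * (x ^ 4 + y * w ^ 3) - (z ^ 3 + (x + y) * w ^ 2) ^ 2

/-- The sextic vanishes on no line through `(0 : 0 : 0 : 1)`. -/
theorem eq_zero_of_forall_sextic_eq_zero {x y z w : ℂ} (hw : w ≠ 0)
    (h : ∀ t : ℂ, sextic x y z (t * w) = 0) : x = 0 ∧ y = 0 ∧ z = 0 := by
  simp only [sextic] at h
  have h0 := h 0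
  have h1 := h 1
  have h2 := h (-1)
  have h3 := h 2
  have h4 := h (-2)
  have hxy : x * y ^ 2 * w ^ 3 = 0 := by linear_combination (h1 - h2) / 2
  have hsum : (x + y) ^ 2 * w ^ 4 = 0 := by
    linear_combination -(h3 + h4 - 4 * (h1 + h2) + 6 * h0) / 24
  have hs : x + y = 0 := by simpa [hw] using hsum
  have hx : x = 0 := by
    have : x * y ^ 2 = 0 := by simpa [hw] using hxy
    have : x ^ 3 = 0 := by linear_combination this + (x ^ 2 - x * y) * hs
    simpa using this
  have hy : y = 0 := by simpa [hx] using hs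
  refine ⟨hx, hy, ?_⟩
  simpa [hx, hy] using h0

/-- The sextic vanishes on no line meeting `x₁ = 0` and `x₂ = 0` in distinct points off
`x₁ = x₂ = 0`. -/
theorem mul_eq_zero_of_forall_sextic_eq_zero {x z w y' z' w' : ℂ}
    (h : ∀ t : ℂ, sextic x (t * y') (z + t * z') (w + t * w') = 0) : x ^ 5 * y' = 0 := by
  simp only [sextic] at h
  have ha : z ^ 3 + x * w ^ 2 = 0 := by simpa using h 0
  linear_combination (45 * (h 1 - h (-1)) - 9 * (h 2 - h (-2)) + (h 3 - h (-3))) / 60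
    + 2 * (3 * z ^ 2 * z' + y' * w ^ 2 + 2 * x * w * w') * ha

theorem discriminant_surface_no_lines :
    ∃ a₃ b₄ : MvPolynomial (Fin 4) ℂ,
      a₃.IsHomogeneous 3 ∧ b₄.IsHomogeneous 4 ∧
      ∀ W : Submodule ℂ (Fin 4 → ℂ), Module.finrank ℂ W = 2 →
        ∃ v ∈ W, eval v (X 0 * X 1 * b₄ - a₃ ^ 2) ≠ 0 := by
  refine ⟨X 2 ^ 3 + (X 0 + X 1) * X 3 ^ 2, X 0 ^ 4 + X 1 * X 3 ^ 3, ?_, ?_, ?_⟩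
  · exact (isHomogeneous_X_pow _ _).add
      (((isHomogeneous_X _ _).add (isHomogeneous_X _ _)).mul (isHomogeneous_X_pow _ _))
  · exact (isHomogeneous_X_pow _ _).add ((isHomogeneous_X _ _).mul (isHomogeneous_X_pow _ _))
  intro W hW
  by_contra! hvan
  have hF : ∀ v ∈ W, sextic (v 0) (v 1) (v 2) (v 3) = 0 := fun v hv => by
    simpa [sextic] using hvan v hv
  have ext_zero : ∀ v : Fin 4 → ℂ, v 0 = 0 → v 1 = 0 → v 2 = 0 → v 3 = 0 → v = 0 := by
    intro v h0 h1 h2 h3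
    ext i
    fin_cases i <;> assumption
  have hzero (i : Fin 4) : ∃ v ∈ W, v ≠ 0 ∧ v i = 0 :=
    W.exists_mem_ne_zero_apply_eq_zero hW (LinearMap.proj i)
  have hline (v) (hv : v ∈ W) (u) (hu : u ∈ W) (t : ℂ) :
      sextic (v 0 + t * u 0) (v 1 + t * u 1) (v 2 + t * u 2) (v 3 + t * u 3) = 0 := by
    simpa using hF (v + t • u) (W.add_mem hv (W.smul_mem t hu))
  have hvertex : ∀ u ∈ W, u 0 = 0 → u 1 = 0 → u = 0 := by
    intro u hu h0 h1
    have h2 : u 2 = 0 := by simpa [sextic, h0, h1] using hF u hu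
    refine ext_zero u h0 h1 h2 ?_
    by_contra h3
    obtain ⟨v, hv, hv0, hv3⟩ := hzero 3
    obtain ⟨e0, e1, e2⟩ := eq_zero_of_forall_sextic_eq_zero (x := v 0) (y := v 1) (z := v 2) h3
      fun t => by simpa [h0, h1, h2, hv3] using hline v hv u hu t
    exact hv0 (ext_zero v e0 e1 e2 hv3)
  obtain ⟨u, hu, hu0, hux⟩ := hzero 0
  obtain ⟨v, hv, hv0, hvy⟩ := hzero 1
  have hprod : v 0 ^ 5 * u 1 = 0 :=
    mul_eq_zero_of_forall_sextic_eq_zero (z := v 2) (w := v 3) (z' := u 2) (w' := u 3)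
      fun t => by simpa [hux, hvy] using hline v hv u hu t
  rcases mul_eq_zero.mp hprod with h | h
  · exact hv0 (hvertex v hv (by simpa using h) hvy)
  · exact hu0 (hvertex u hu hux h)
end

section
/- There exist homogeneous polynomials a₃ of degree 3 and b₄ of degree 4 in ℂ[x₁,x₂,x₃,x₄] such that for every injective linear map φ : ℂ³ → ℂ⁵, the homogeneous quartic obtained by composing F = x₀²x₁x₂ + x₀a₃ + b₄ with φ is nonzero and squarefree in ℂ[u,v,w]; equivalently, every plane section of the quartic 3-fold X = {F = 0} ⊂ ℙ⁴ is a reduced curve. (This is the Claim at the end of the exclusion of plane-curve maximal centers: if X is general, every plane section of X is reduced, so the cases of a nonreduced residual curve—conic plus double line, or double conic—do not occur.) -/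
open MvPolynomial

section HomogeneousFactors

variable {σ R : Type*} [CommRing R]

/-- The top homogeneous component of a product is the product of the top homogeneous components. -/
lemma homogeneousComponent_add_mul (p q : MvPolynomial σ R) {m n : ℕ}
    (hp : p.totalDegree ≤ m) (hq : q.totalDegree ≤ n) :
    homogeneousComponent (m + n) (p * q) =
      homogeneousComponent m p * homogeneousComponent n q := by
  classical
  have big : ∀ (r : MvPolynomial σ R) (k : ℕ) (d : σ →₀ ℕ), r.totalDegree ≤ k → k < d.degree →
      coeff d r = 0 := by
    intro r k d hr hd
    apply coeff_eq_zero_of_totalDegree_lt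
    rw [← Finsupp.degree_apply]
    omega
  ext d
  rw [coeff_homogeneousComponent, coeff_mul, coeff_mul]
  split_ifs with hd
  · refine Finset.sum_congr rfl fun x hx => ?_
    rw [Finset.HasAntidiagonal.mem_antidiagonal] at hx
    have hdeg : x.1.degree + x.2.degree = m + n := by rw [← hd, ← hx, map_add]
    rw [coeff_homogeneousComponent, coeff_homogeneousComponent]
    split_ifs with h1 h2 h2
    · rfl
    · omega
    · omega
    · rcases lt_or_gt_of_ne h1 with h | h
      · rw [big q n x.2 hq (by omega)]; simp
      · rw [big p m x.1 hp (by omega)]; simp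
  · symm
    refine Finset.sum_eq_zero fun x hx => ?_
    rw [Finset.HasAntidiagonal.mem_antidiagonal] at hx
    have hdeg : x.1.degree + x.2.degree = d.degree := by rw [← hx, map_add]
    rw [coeff_homogeneousComponent, coeff_homogeneousComponent]
    split_ifs with h1 h2 h2
    · omega
    · simp
    · simp
    · simp

/-- `G` has a square factor that is a form of degree one or two, the cofactor being a form. -/
def HasSquareFactor (G : MvPolynomial σ R) : Prop :=
  ∃ g h : MvPolynomial σ R, G = g ^ 2 * h ∧
    (g.IsHomogeneous 1 ∧ h.IsHomogeneous 2 ∨ g.IsHomogeneous 2 ∧ h.IsHomogeneous 0)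

lemma hasSquareFactor_of_not_squarefree {F : Type*} [Field F] {G : MvPolynomial σ F}
    (hG : G.IsHomogeneous 4) (hsq : ¬ Squarefree G) : HasSquareFactor G := by
  rcases eq_or_ne G 0 with rfl | hG0
  · exact ⟨0, 0, by simp, Or.inl ⟨isHomogeneous_zero _ _ _, isHomogeneous_zero _ _ _⟩⟩
  simp only [Squarefree, not_forall] at hsq
  obtain ⟨g, ⟨h, rfl⟩, hg⟩ := hsq
  have hg0 : g ≠ 0 := by rintro rfl; simp at hG0
  have hh0 : h ≠ 0 := by rintro rfl; simp at hG0
  have hdeg : g.totalDegree ≠ 0 := by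
    intro h0
    apply hg
    rw [totalDegree_eq_zero_iff_eq_C] at h0
    rw [h0]
    apply IsUnit.map
    rw [isUnit_iff_ne_zero]
    intro h1
    rw [h1, C_0] at h0
    exact hg0 h0
  have hsum : g.totalDegree + g.totalDegree + h.totalDegree = 4 := by
    rw [← hG.totalDegree hG0, totalDegree_mul_of_isDomain (mul_ne_zero hg0 hg0) hh0,
      totalDegree_mul_of_isDomain hg0 hg0]
  have key : g * g * h =
      homogeneousComponent g.totalDegree g ^ 2 * homogeneousComponent h.totalDegree h := by
    rw [sq, ← homogeneousComponent_add_mul g g le_rfl le_rfl,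
      ← homogeneousComponent_add_mul (g * g) h (totalDegree_mul _ _) le_rfl, hsum,
      homogeneousComponent_eq_self hG]
  refine ⟨_, _, key, ?_⟩
  have h12 : g.totalDegree = 1 ∧ h.totalDegree = 2 ∨ g.totalDegree = 2 ∧ h.totalDegree = 0 := by
    omega
  rcases h12 with ⟨h1, h2⟩ | ⟨h1, h2⟩
  · rw [h1, h2]
    exact Or.inl ⟨homogeneousComponent_isHomogeneous _ _, homogeneousComponent_isHomogeneous _ _⟩
  · rw [h1, h2]
    exact Or.inr ⟨homogeneousComponent_isHomogeneous _ _, homogeneousComponent_isHomogeneous _ _⟩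

lemma HasSquareFactor.aeval {τ : Type*} {G : MvPolynomial σ R} (hG : HasSquareFactor G)
    {A : σ → MvPolynomial τ R} (hA : ∀ i, (A i).IsHomogeneous 1) :
    HasSquareFactor (MvPolynomial.aeval A G) := by
  obtain ⟨g, h, rfl, hgh⟩ := hG
  refine ⟨MvPolynomial.aeval A g, MvPolynomial.aeval A h, by simp, ?_⟩
  rcases hgh with ⟨h1, h2⟩ | ⟨h1, h2⟩
  · exact Or.inl ⟨by simpa using h1.aeval A hA, by simpa using h2.aeval A hA⟩
  · exact Or.inr ⟨by simpa using h1.aeval A hA, by simpa using h2.aeval A hA⟩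

end HomogeneousFactors

lemma isHomogeneous_eq_sum {R : Type*} [CommRing R] {k n : ℕ} {p : MvPolynomial (Fin k) R}
    (hp : p.IsHomogeneous n) :
    p = ∑ m ∈ Finset.Nat.antidiagonalTuple k n,
      C (coeff (Finsupp.equivFunOnFinite.symm m) p) * ∏ i, X i ^ m i := by
  classical
  have hmon : ∀ m : Fin k → ℕ, ∀ a : R, C a * ∏ i, (X i : MvPolynomial (Fin k) R) ^ m i =
      monomial (Finsupp.equivFunOnFinite.symm m) a := by
    intro m a
    rw [monomial_eq, Finsupp.prod_fintype _ _ (by simp)]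
    simp
  simp_rw [hmon]
  ext d
  rw [coeff_sum]
  simp_rw [coeff_monomial]
  by_cases hd : d.degree = n
  · rw [Finset.sum_eq_single (d : Fin k → ℕ)]
    · simp
    · intro b _ hb
      rw [if_neg]
      rintro rfl
      exact hb (by simp)
    · intro h
      exact absurd (by
        rw [Finset.Nat.mem_antidiagonalTuple, ← hd, Finsupp.degree_eq_sum]) h
  · rw [hp.coeff_eq_zero hd, Finset.sum_eq_zero]
    intro m hm
    rw [if_neg]
    rintro rfl
    rw [Finset.Nat.mem_antidiagonalTuple] at hm
    apply hd
    rw [Finsupp.degree_eq_sum, ← hm]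
    rfl

lemma IsHomogeneous.exists_linear {R : Type*} [CommRing R] {p : MvPolynomial (Fin 3) R}
    (hp : p.IsHomogeneous 1) : ∃ a b c : R, p = C a * X 0 + C b * X 1 + C c * X 2 := by
  have h : Finset.Nat.antidiagonalTuple 3 1 = {![1, 0, 0], ![0, 1, 0], ![0, 0, 1]} := by decide
  have := isHomogeneous_eq_sum hp
  rw [h] at this
  set f : (Fin 3 → ℕ) → R := fun m => coeff (Finsupp.equivFunOnFinite.symm m) p with hf
  refine ⟨f ![1, 0, 0], f ![0, 1, 0], f ![0, 0, 1], this.trans ?_⟩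
  rw [Finset.sum_insert (by decide), Finset.sum_insert (by decide), Finset.sum_singleton]
  simp [Fin.prod_univ_three]
  rw [add_assoc]

lemma IsHomogeneous.exists_quadratic {R : Type*} [CommRing R] {p : MvPolynomial (Fin 3) R}
    (hp : p.IsHomogeneous 2) : ∃ a b c d e f : R, p = C a * X 0 ^ 2 + C b * (X 0 * X 1) +
      C c * (X 0 * X 2) + C d * X 1 ^ 2 + C e * (X 1 * X 2) + C f * X 2 ^ 2 := by
  have h : Finset.Nat.antidiagonalTuple 3 2 = {![2, 0, 0], ![1, 1, 0], ![1, 0, 1], ![0, 2, 0],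
    ![0, 1, 1], ![0, 0, 2]} := by decide
  have := isHomogeneous_eq_sum hp
  rw [h] at this
  set f : (Fin 3 → ℕ) → R := fun m => coeff (Finsupp.equivFunOnFinite.symm m) p with hf
  refine ⟨f ![2, 0, 0], f ![1, 1, 0], f ![1, 0, 1], f ![0, 2, 0], f ![0, 1, 1], f ![0, 0, 2],
    this.trans ?_⟩
  rw [Finset.sum_insert (by decide), Finset.sum_insert (by decide), Finset.sum_insert (by decide),
    Finset.sum_insert (by decide), Finset.sum_insert (by decide), Finset.sum_singleton]
  simp [Fin.prod_univ_three]
  simp only [add_assoc, hf]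

lemma IsHomogeneous.exists_const {σ R : Type*} [CommRing R] {p : MvPolynomial σ R}
    (hp : p.IsHomogeneous 0) : ∃ a : R, p = C a :=
  ⟨_, totalDegree_eq_zero_iff_eq_C.1 ((totalDegree_zero_iff_isHomogeneous _).2 hp)⟩

section Transcendence

/-- The polynomials all of whose coefficients lie in the `ℚ`-subalgebra generated by `L`. -/
noncomputable def polynomialsOver (σ : Type*) (L : Set ℂ) : Subring (MvPolynomial σ ℂ) :=
  (MvPolynomial.map (algebraMap (Algebra.adjoin ℚ L) ℂ)).range

variable {σ τ : Type*} {L : Set ℂ}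

lemma C_mem_polynomialsOver {z : ℂ} (hz : z ∈ Algebra.adjoin ℚ L) :
    C z ∈ polynomialsOver σ L :=
  ⟨C ⟨z, hz⟩, by simp⟩

lemma X_mem_polynomialsOver (i : σ) : X i ∈ polynomialsOver σ L :=
  ⟨X i, by simp⟩

lemma coeff_mem_of_mem_polynomialsOver {p : MvPolynomial σ ℂ} (hp : p ∈ polynomialsOver σ L)
    (m : σ →₀ ℕ) : coeff m p ∈ Algebra.adjoin ℚ L := by
  obtain ⟨q, rfl⟩ := hp
  rw [coeff_map]
  exact (coeff m q).2

lemma aeval_mem_polynomialsOver {p : MvPolynomial σ ℂ} (hp : p ∈ polynomialsOver σ L)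
    {A : σ → MvPolynomial τ ℂ} (hA : ∀ i, A i ∈ polynomialsOver τ L) :
    aeval A p ∈ polynomialsOver τ L := by
  rw [aeval_def, eval₂_eq]
  refine Subring.sum_mem _ fun m _ => Subring.mul_mem _
    (C_mem_polynomialsOver (coeff_mem_of_mem_polynomialsOver hp m))
    (Subring.prod_mem _ fun i _ => Subring.pow_mem _ (hA i) _)

lemma polynomialsOver_mono {L' : Set ℂ} (h : L ⊆ L') :
    polynomialsOver σ L ≤ polynomialsOver σ L' := by
  rintro _ ⟨q, rfl⟩
  induction q using MvPolynomial.induction_on with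
  | C a => simpa using C_mem_polynomialsOver (Algebra.adjoin_mono h a.2)
  | add p q hp hq => rw [map_add]; exact Subring.add_mem _ hp hq
  | mul_X p i hp => rw [map_mul, map_X]; exact Subring.mul_mem _ hp (X_mem_polynomialsOver i)

lemma card_le_of_algebraicIndependent {R : Type*} [CommRing R] [Algebra ℚ R] {κ : Type*}
    [Fintype κ] {x : κ → R} (hx : AlgebraicIndependent ℚ x) (T : Finset R)
    (hT : ∀ k, x k ∈ Algebra.adjoin ℚ (T : Set R)) : Fintype.card κ ≤ T.card := by
  have h : ∀ k, ∃ f : MvPolynomial T ℚ, aeval (Subtype.val : T → R) f = x k := by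
    intro k
    have := hT k
    have h2 : (T : Set R) = Set.range (Subtype.val : T → R) := by ext; simp
    rw [h2, Algebra.adjoin_range_eq_range_aeval] at this
    exact this
  choose f hf using h
  have hfi : AlgebraicIndependent ℚ f := by
    have hinj : AlgebraicIndependent ℚ (aeval (Subtype.val : T → R) ∘ f) := by
      convert hx using 1
      exact funext hf
    exact hinj.of_comp _
  have := hfi.lift_cardinalMk_le_trdeg
  rw [MvPolynomial.trdeg_of_isDomain] at this
  simpa using this

lemma exists_algebraicIndependent_complex (κ : Type) [Countable κ] :
    ∃ c : κ → ℂ, AlgebraicIndependent ℚ c := by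
  obtain ⟨ι, x, hx⟩ := exists_isTranscendenceBasis' ℚ ℂ
  have hcard : Cardinal.mk ℂ = Cardinal.mk ι :=
    IsAlgClosed.cardinal_eq_cardinal_transcendence_basis_of_aleph0_lt' x hx (by simp)
      (by rw [Cardinal.mk_complex]; exact Cardinal.aleph0_lt_continuum)
  have hle : Cardinal.mk κ ≤ Cardinal.mk ι := by
    rw [← hcard, Cardinal.mk_complex]
    exact (Cardinal.mk_le_aleph0).trans Cardinal.aleph0_le_continuum
  obtain ⟨e⟩ := Cardinal.le_def _ _ |>.1 hle
  exact ⟨x ∘ e, hx.1.comp _ e.injective⟩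

end Transcendence

section GenericQuartic

/-- The form of degree `d` in four variables whose coefficients are given by `c`. -/
noncomputable def formOfCoeffs (c : (Fin 4 → ℕ) → ℂ) (d : ℕ) : MvPolynomial (Fin 4) ℂ :=
  ∑ m ∈ Finset.Nat.antidiagonalTuple 4 d, C (c m) * ∏ i, X i ^ m i

lemma formOfCoeffs_isHomogeneous (c : (Fin 4 → ℕ) → ℂ) (d : ℕ) :
    (formOfCoeffs c d).IsHomogeneous d := by
  refine IsHomogeneous.sum _ _ _ fun m hm => ?_
  rw [Finset.Nat.mem_antidiagonalTuple] at hm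
  rw [← hm]
  exact (IsHomogeneous.prod _ _ _ fun i _ => isHomogeneous_X_pow i (m i)).C_mul _

/-- The quartic `x₀²x₁x₂ + x₀a₃ + b₄`, where the coefficients of `a₃` and `b₄` are given by `c`. -/
noncomputable def quartic (c : (Fin 4 → ℕ) → ℂ) : MvPolynomial (Fin 5) ℂ :=
  X 0 ^ 2 * X 1 * X 2 + X 0 * rename Fin.succ (formOfCoeffs c 3) +
    rename Fin.succ (formOfCoeffs c 4)

lemma quartic_isHomogeneous (c : (Fin 4 → ℕ) → ℂ) : (quartic c).IsHomogeneous 4 :=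
  ((((isHomogeneous_X_pow 0 2).mul (isHomogeneous_X ℂ 1)).mul (isHomogeneous_X ℂ 2)).add
    ((isHomogeneous_X ℂ 0).mul (formOfCoeffs_isHomogeneous c 3).rename_isHomogeneous)).add
    (formOfCoeffs_isHomogeneous c 4).rename_isHomogeneous

/-- Exponents of the monomials of degree three or four in four variables. -/
def cubicQuarticExponents : Finset (Fin 4 → ℕ) :=
  Finset.Nat.antidiagonalTuple 4 3 ∪ Finset.Nat.antidiagonalTuple 4 4

variable {R : Type*} [CommRing R]

/-- The monomial of degree four in five variables with exponents `m` in the last four variables,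
evaluated at `ψ`. -/
def quarticMonomial (ψ : Fin 5 → R) (m : Fin 4 → ℕ) : R :=
  ψ 0 ^ (4 - ∑ i, m i) * ∏ i, ψ (Fin.succ i) ^ m i

lemma aeval_quartic [Algebra ℂ R] (c : (Fin 4 → ℕ) → ℂ) (ψ : Fin 5 → R) :
    aeval ψ (quartic c) = ψ 0 ^ 2 * ψ 1 * ψ 2 +
      ∑ m ∈ cubicQuarticExponents, algebraMap ℂ R (c m) * quarticMonomial ψ m := by
  rw [cubicQuarticExponents, Finset.sum_union (by decide), quartic, ← add_assoc]
  simp only [map_add, map_mul, map_pow, aeval_X, aeval_rename, formOfCoeffs, map_sum, map_prod,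
    aeval_C, Function.comp_apply, Finset.mul_sum]
  congr 1
  · congr 1
    refine Finset.sum_congr rfl fun m hm => ?_
    rw [Finset.Nat.mem_antidiagonalTuple] at hm
    rw [quarticMonomial, hm]
    ring
  · refine Finset.sum_congr rfl fun m hm => ?_
    rw [Finset.Nat.mem_antidiagonalTuple] at hm
    rw [quarticMonomial, hm]
    ring

/-- If the restriction of the quartic with algebraically independent coefficients along `ψ` is
defined over the algebra generated by a finite set `S`, and so is `ψ`, then `S` is at least as
large as the set of monomials that `ψ` maps to distinct monomials. -/
theorem card_le_of_aeval_quartic_mem {c : (Fin 4 → ℕ) → ℂ} (hc : AlgebraicIndependent ℚ c)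
    {σ : Type*} {S : Finset ℂ} {ψ : Fin 5 → MvPolynomial σ ℂ}
    (hψ : ∀ i, ψ i ∈ polynomialsOver σ (S : Set ℂ))
    (hF : aeval ψ (quartic c) ∈ polynomialsOver σ (S : Set ℂ))
    {J : Finset (Fin 4 → ℕ)} (hJ : J ⊆ cubicQuarticExponents) {e : (Fin 4 → ℕ) → σ →₀ ℕ}
    (he : Set.InjOn e J) (hm : ∀ m ∈ J, quarticMonomial ψ m = monomial (e m) 1) :
    J.card ≤ S.card := by
  classical
  set T : Finset ℂ := S ∪ (cubicQuarticExponents \ J).image c with hT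
  have hST : (S : Set ℂ) ⊆ T := by rw [hT]; simp
  have hψT := fun i => polynomialsOver_mono (σ := σ) hST (hψ i)
  have hmon : ∀ m, quarticMonomial ψ m ∈ polynomialsOver σ (T : Set ℂ) := fun m =>
    Subring.mul_mem _ (Subring.pow_mem _ (hψT 0) _)
      (Subring.prod_mem _ fun i _ => Subring.pow_mem _ (hψT _) _)
  have hout : ∀ m ∈ cubicQuarticExponents \ J, c m ∈ Algebra.adjoin ℚ (T : Set ℂ) := fun m hm =>
    Algebra.subset_adjoin (by
      rw [hT, Finset.mem_coe]
      exact Finset.mem_union_right _ (Finset.mem_image_of_mem c hm))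
  have hsum : ∑ m ∈ J, C (c m) * monomial (e m) 1 ∈ polynomialsOver σ (T : Set ℂ) := by
    have h1 := polynomialsOver_mono (σ := σ) hST hF
    rw [aeval_quartic, ← Finset.sum_sdiff hJ, ← add_assoc] at h1
    have h2 : ∑ m ∈ J, C (c m) * monomial (e m) 1 =
        ∑ m ∈ J, algebraMap ℂ (MvPolynomial σ ℂ) (c m) * quarticMonomial ψ m :=
      Finset.sum_congr rfl fun m hmJ => by rw [hm m hmJ]; rfl
    rw [h2]
    refine (add_mem_cancel_left ?_).1 h1
    refine Subring.add_mem _ ?_ (Subring.sum_mem _ fun m hm => Subring.mul_mem _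
      (C_mem_polynomialsOver (hout m hm)) (hmon m))
    exact Subring.mul_mem _ (Subring.mul_mem _ (Subring.pow_mem _ (hψT 0) _) (hψT 1)) (hψT 2)
  have hin : ∀ m ∈ J, c m ∈ Algebra.adjoin ℚ (T : Set ℂ) := by
    intro m hmJ
    have := coeff_mem_of_mem_polynomialsOver hsum (e m)
    rw [coeff_sum, Finset.sum_eq_single m] at this
    · simpa [coeff_C_mul] using this
    · intro b hb hbm
      rw [coeff_C_mul, coeff_monomial, if_neg, mul_zero]
      exact fun h => hbm (he hb hmJ h)
    · exact fun h => absurd hmJ h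
  have hall : ∀ m : cubicQuarticExponents, c m ∈ Algebra.adjoin ℚ (T : Set ℂ) := by
    rintro ⟨m, hmD⟩
    by_cases h : m ∈ J
    · exact hin m h
    · exact hout m (by simp [hmD, h])
  have hcard := card_le_of_algebraicIndependent
    (hc.comp (Subtype.val : cubicQuarticExponents → _) Subtype.val_injective) T hall
  rw [Fintype.card_coe] at hcard
  have h1 : T.card ≤ S.card + (cubicQuarticExponents.card - J.card) := by
    rw [← Finset.card_sdiff_of_subset hJ]
    exact (Finset.card_union_le _ _).trans (Nat.add_le_add_left Finset.card_image_le _)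
  have h2 := Finset.card_le_card hJ
  omega

end GenericQuartic

section PlanesAvoidingPoint

lemma linear_mem_polynomialsOver {L : Set ℂ} {a b c : ℂ} (ha : a ∈ Algebra.adjoin ℚ L)
    (hb : b ∈ Algebra.adjoin ℚ L) (hc : c ∈ Algebra.adjoin ℚ L) :
    (C a * X 0 + C b * X 1 + C c * X 2 : MvPolynomial (Fin 3) ℂ) ∈
      polynomialsOver (Fin 3) L := by
  refine Subring.add_mem _ (Subring.add_mem _ ?_ ?_) ?_ <;>
  exact Subring.mul_mem _ (C_mem_polynomialsOver (by assumption)) (X_mem_polynomialsOver _)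

lemma quadratic_mem_polynomialsOver {L : Set ℂ} {a b c d e f : ℂ} (ha : a ∈ Algebra.adjoin ℚ L)
    (hb : b ∈ Algebra.adjoin ℚ L) (hc : c ∈ Algebra.adjoin ℚ L) (hd : d ∈ Algebra.adjoin ℚ L)
    (he : e ∈ Algebra.adjoin ℚ L) (hf : f ∈ Algebra.adjoin ℚ L) :
    (C a * X 0 ^ 2 + C b * (X 0 * X 1) + C c * (X 0 * X 2) + C d * X 1 ^ 2 + C e * (X 1 * X 2) +
      C f * X 2 ^ 2 : MvPolynomial (Fin 3) ℂ) ∈ polynomialsOver (Fin 3) L := by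
  have hX := fun i : Fin 3 => X_mem_polynomialsOver (L := L) i
  refine Subring.add_mem _ (Subring.add_mem _ (Subring.add_mem _ (Subring.add_mem _
    (Subring.add_mem _ ?_ ?_) ?_) ?_) ?_) ?_ <;>
  refine Subring.mul_mem _ (C_mem_polynomialsOver (by assumption)) ?_ <;>
  first
  | exact Subring.pow_mem _ (hX _) _
  | exact Subring.mul_mem _ (hX _) (hX _)

/-- A ternary quartic with a square factor is defined over an algebra with eight generators. -/
lemma HasSquareFactor.exists_generators {G : MvPolynomial (Fin 3) ℂ} (hG : HasSquareFactor G) :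
    ∃ S : Finset ℂ, S.card ≤ 8 ∧ G ∈ polynomialsOver (Fin 3) (S : Set ℂ) := by
  classical
  obtain ⟨g, h, rfl, ⟨hg, hh⟩ | ⟨hg, hh⟩⟩ := hG
  · obtain ⟨a, b, c, rfl⟩ := IsHomogeneous.exists_linear hg
    obtain ⟨h0, h1, h2, h3, h4, h5, rfl⟩ := IsHomogeneous.exists_quadratic hh
    have hnorm : ∃ s a' b' c' x y : ℂ, a = s * a' ∧ b = s * b' ∧ c = s * c' ∧
        (a' = 1 ∨ a' = x ∨ a' = y) ∧ (b' = 1 ∨ b' = x ∨ b' = y) ∧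
        (c' = 1 ∨ c' = x ∨ c' = y) := by
      by_cases ha : a = 0
      · by_cases hb : b = 0
        · exact ⟨c, 0, 0, 1, 0, 0, by simp [ha], by simp [hb], by simp, by simp⟩
        · exact ⟨b, 0, 1, c / b, 0, c / b, by simp [ha], by simp, by field_simp, by simp⟩
      · exact ⟨a, 1, b / a, c / a, b / a, c / a, by simp, by field_simp, by field_simp, by simp⟩
    obtain ⟨s, a', b', c', x, y, rfl, rfl, rfl, ha, hb, hc⟩ := hnorm
    set l : List ℂ := [x, y, s ^ 2 * h0, s ^ 2 * h1, s ^ 2 * h2, s ^ 2 * h3, s ^ 2 * h4,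
      s ^ 2 * h5] with hl
    have hmem : ∀ z ∈ l, z ∈ Algebra.adjoin ℚ (l.toFinset : Set ℂ) := fun z hz =>
      Algebra.subset_adjoin (by simpa using hz)
    have hxy : ∀ z : ℂ, z = 1 ∨ z = x ∨ z = y → z ∈ Algebra.adjoin ℚ (l.toFinset : Set ℂ) := by
      rintro z (rfl | rfl | rfl)
      · exact Subalgebra.one_mem _
      · exact hmem _ (by simp [hl])
      · exact hmem _ (by simp [hl])
    refine ⟨l.toFinset, l.toFinset_card_le, ?_⟩
    have key := Subring.mul_mem _ (Subring.pow_mem _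
      (linear_mem_polynomialsOver (hxy a' ha) (hxy b' hb) (hxy c' hc)) 2)
      (quadratic_mem_polynomialsOver (hmem (s ^ 2 * h0) (by simp [hl]))
        (hmem (s ^ 2 * h1) (by simp [hl])) (hmem (s ^ 2 * h2) (by simp [hl]))
        (hmem (s ^ 2 * h3) (by simp [hl])) (hmem (s ^ 2 * h4) (by simp [hl]))
        (hmem (s ^ 2 * h5) (by simp [hl])))
    convert key using 1
    simp only [C_mul, C_pow]
    ring
  · obtain ⟨a, b, c, d, e, f, rfl⟩ := IsHomogeneous.exists_quadratic hg
    obtain ⟨z, rfl⟩ := IsHomogeneous.exists_const hh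
    set l : List ℂ := [a, b, c, d, e, f, z] with hl
    have hmem : ∀ z ∈ l, z ∈ Algebra.adjoin ℚ (l.toFinset : Set ℂ) := fun z hz =>
      Algebra.subset_adjoin (by simpa using hz)
    refine ⟨l.toFinset, l.toFinset_card_le.trans (by simp [hl]), ?_⟩
    exact Subring.mul_mem _ (Subring.pow_mem _ (quadratic_mem_polynomialsOver
      (hmem a (by simp [hl])) (hmem b (by simp [hl])) (hmem c (by simp [hl]))
      (hmem d (by simp [hl])) (hmem e (by simp [hl])) (hmem f (by simp [hl]))) 2)
      (C_mem_polynomialsOver (hmem z (by simp [hl])))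

lemma exists_succAbove_dual_basis {F : Type*} [Field F] {n : ℕ}
    {f : (Fin n → F) →ₗ[F] (Fin (n + 1) → F)} (hf : Function.Injective f) :
    ∃ (i : Fin (n + 1)) (w : Fin n → Fin n → F),
      ∀ t, (fun s => f (w t) (i.succAbove s)) = Pi.single t 1 := by
  by_cases h : ∃ i : Fin (n + 1),
      Function.Injective (LinearMap.funLeft F F i.succAbove ∘ₗ f)
  · obtain ⟨i, hi⟩ := h
    refine ⟨i, fun t => (LinearEquiv.ofInjectiveEndo _ hi).symm (Pi.single t 1), fun t => ?_⟩
    exact (LinearEquiv.ofInjectiveEndo _ hi).apply_symm_apply (Pi.single t 1)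
  · exfalso
    push Not at h
    have hrange : LinearMap.range f = ⊤ := by
      rw [eq_top_iff, ← (Pi.basisFun F (Fin (n + 1))).span_eq, Submodule.span_le]
      rintro _ ⟨i, rfl⟩
      have hi := h i
      rw [← LinearMap.ker_eq_bot, Submodule.eq_bot_iff] at hi
      push Not at hi
      obtain ⟨u, hu, hu0⟩ := hi
      have hzero : ∀ s, f u (i.succAbove s) = 0 := fun s => congrFun (LinearMap.mem_ker.1 hu) s
      have hne : f u i ≠ 0 := by
        intro h0
        apply hu0
        apply hf
        rw [map_zero]
        funext r
        rcases Fin.eq_self_or_eq_succAbove i r with rfl | ⟨s, rfl⟩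
        · exact h0
        · exact hzero s
      refine ⟨(f u i)⁻¹ • u, ?_⟩
      funext r
      rcases Fin.eq_self_or_eq_succAbove i r with rfl | ⟨s, rfl⟩
      · simp [hne]
      · simp [hzero]
    have h1 := LinearMap.finrank_range_le f
    rw [hrange, finrank_top] at h1
    simp at h1

/-- The linear forms that parametrize the subspace spanned by the vectors `w`. -/
noncomputable def spanForms {κ : Type*} (w : Fin 3 → κ → ℂ) (i : κ) : MvPolynomial (Fin 3) ℂ :=
  ∑ t, C (w t i) * X t

lemma spanForms_isHomogeneous {κ : Type*} (w : Fin 3 → κ → ℂ) (i : κ) :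
    (spanForms w i).IsHomogeneous 1 :=
  IsHomogeneous.sum _ _ _ fun _ _ => isHomogeneous_C_mul_X _ _

lemma aeval_spanForms_spanForms {κ : Type*} (φ : (Fin 3 → ℂ) →ₗ[ℂ] (κ → ℂ))
    (w : Fin 3 → Fin 3 → ℂ) (i : κ) :
    aeval (spanForms w) (spanForms (fun j => φ (Pi.single j 1)) i) =
      spanForms (fun t => φ (w t)) i := by
  have h : ∀ t, φ (w t) i = ∑ j, w t j * φ (Pi.single j 1) i := by
    intro t
    conv_lhs => rw [pi_eq_sum_univ' (w t)]
    simp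
  simp only [spanForms, map_sum, map_mul, aeval_X, algHom_C, h, Finset.sum_mul, Finset.mul_sum,
    algebraMap_eq]
  rw [Finset.sum_comm]
  refine Finset.sum_congr rfl fun t _ => Finset.sum_congr rfl fun j _ => ?_
  ring

lemma aeval_spanForms_quartic {c : (Fin 4 → ℕ) → ℂ} (φ : (Fin 3 → ℂ) →ₗ[ℂ] (Fin 5 → ℂ))
    (w : Fin 3 → Fin 3 → ℂ) :
    aeval (spanForms w) (aeval (spanForms (fun j => φ (Pi.single j 1))) (quartic c)) =
      aeval (spanForms (fun t => φ (w t))) (quartic c) := by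
  rw [← AlgHom.comp_apply, comp_aeval]
  simp only [aeval_spanForms_spanForms]

lemma not_hasSquareFactor_of_notMem_range {c : (Fin 4 → ℕ) → ℂ} (hc : AlgebraicIndependent ℚ c)
    {φ : (Fin 3 → ℂ) →ₗ[ℂ] (Fin 5 → ℂ)}
    (hφ : Function.Injective (LinearMap.funLeft ℂ ℂ (Fin.succ : Fin 4 → Fin 5) ∘ₗ φ)) :
    ¬ HasSquareFactor (aeval (spanForms (fun j => φ (Pi.single j 1))) (quartic c)) := by
  classical
  intro hG
  obtain ⟨i, w, hw⟩ := exists_succAbove_dual_basis hφ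
  have hG' := hG.aeval (spanForms_isHomogeneous w)
  rw [aeval_spanForms_quartic] at hG'
  obtain ⟨S₀, hS₀, hmem⟩ := hG'.exists_generators
  set ψ := spanForms (fun t => φ (w t)) with hψ
  have hX : ∀ s, ψ (i.succAbove s).succ = X s := by
    intro s
    have : ∀ t, φ (w t) (i.succAbove s).succ = (Pi.single t 1 : Fin 3 → ℂ) s := fun t =>
      congrFun (hw t) s
    simp only [hψ, spanForms, this]
    rw [Finset.sum_eq_single s]
    · simp
    · intro t _ hts
      simp [hts.symm]
    · simp
  set l : List ℂ := [φ (w 0) 0, φ (w 1) 0, φ (w 2) 0, φ (w 0) i.succ, φ (w 1) i.succ,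
    φ (w 2) i.succ] with hl
  have hcard : (S₀ ∪ l.toFinset).card ≤ 14 :=
    (Finset.card_union_le _ _).trans (add_le_add hS₀ l.toFinset_card_le)
  have hlmem : ∀ z ∈ l, z ∈ Algebra.adjoin ℚ ((S₀ ∪ l.toFinset : Finset ℂ) : Set ℂ) := fun z hz =>
    Algebra.subset_adjoin (by
      rw [Finset.mem_coe]
      exact Finset.mem_union_right _ (List.mem_toFinset.2 hz))
  have hψmem : ∀ r, ψ r ∈ polynomialsOver (Fin 3) ((S₀ ∪ l.toFinset : Finset ℂ) : Set ℂ) := by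
    intro r
    refine Fin.cases ?_ (fun r => ?_) r
    · rw [hψ, spanForms, Fin.sum_univ_three]
      exact linear_mem_polynomialsOver (hlmem _ (by simp [hl])) (hlmem _ (by simp [hl]))
        (hlmem _ (by simp [hl]))
    · rcases Fin.eq_self_or_eq_succAbove i r with rfl | ⟨s, rfl⟩
      · rw [hψ, spanForms, Fin.sum_univ_three]
        exact linear_mem_polynomialsOver (hlmem _ (by simp [hl])) (hlmem _ (by simp [hl]))
          (hlmem _ (by simp [hl]))
      · rw [hX]
        exact X_mem_polynomialsOver s
  have key := card_le_of_aeval_quartic_mem hc hψmem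
    (polynomialsOver_mono (by simp) hmem)
    (J := (Finset.Nat.antidiagonalTuple 4 4).filter (fun m => m i = 0))
    (e := fun m => Finsupp.equivFunOnFinite.symm (fun s => m (i.succAbove s)))
    ((Finset.filter_subset _ _).trans Finset.subset_union_right) ?_ ?_
  · have hJ : ∀ i : Fin 4,
        ((Finset.Nat.antidiagonalTuple 4 4).filter (fun m => m i = 0)).card = 15 := by decide
    rw [hJ] at key
    omega
  · intro m hm m' hm' h
    simp only [Finset.coe_filter, Set.mem_ofPred_eq] at hm hm'
    have h' := Finsupp.equivFunOnFinite.symm.injective h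
    funext r
    rcases Fin.eq_self_or_eq_succAbove i r with rfl | ⟨s, rfl⟩
    · rw [hm.2, hm'.2]
    · exact congrFun h' s
  · intro m hm
    rw [Finset.mem_filter, Finset.Nat.mem_antidiagonalTuple] at hm
    rw [quarticMonomial, hm.1, Fin.prod_univ_succAbove _ i, hm.2, monomial_eq,
      Finsupp.prod_fintype _ _ (by simp)]
    simp [hX]

end PlanesAvoidingPoint

section PlanesThroughPoint

/-- The vectors `p` and `v` lie in the hyperplane where the first coordinate vanishes, and are
reduced with respect to the pivots `i` and `j`. -/
structure IsReducedPair (p v : Fin 5 → ℂ) (i j : Fin 4) : Prop where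
  ne : i ≠ j
  left_zero : p 0 = 0
  right_zero : v 0 = 0
  left_pivot : p i.succ = 1
  right_at_left_pivot : v i.succ = 0
  right_pivot : v j.succ = 1

variable {p v : Fin 5 → ℂ} {i j : Fin 4}

lemma mem_adjoin_list {l : List ℂ} {z : ℂ} (hz : z ∈ l) :
    z ∈ Algebra.adjoin ℚ ((l.toFinset : Finset ℂ) : Set ℂ) :=
  Algebra.subset_adjoin (by simpa using hz)

/-- The coordinates of a reduced pair lie in an algebra with five generators. -/
lemma IsReducedPair.exists_generators (h : IsReducedPair p v i j) :
    ∃ l : List ℂ, l.length ≤ 5 ∧ ∀ r, p r ∈ Algebra.adjoin ℚ ((l.toFinset : Finset ℂ) : Set ℂ) ∧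
      v r ∈ Algebra.adjoin ℚ ((l.toFinset : Finset ℂ) : Set ℂ) := by
  have hcover : ∀ i j : Fin 4, i ≠ j → ∃ k l, ∀ r, r = i ∨ r = j ∨ r = k ∨ r = l := by decide
  obtain ⟨k, m, hr⟩ := hcover i j h.ne
  refine ⟨[p j.succ, p k.succ, p m.succ, v k.succ, v m.succ], by simp, fun r => ?_⟩
  refine Fin.cases ?_ (fun r => ?_) r
  · rw [h.left_zero, h.right_zero]
    exact ⟨Subalgebra.zero_mem _, Subalgebra.zero_mem _⟩
  · rcases hr r with rfl | rfl | rfl | rfl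
    · rw [h.left_pivot, h.right_at_left_pivot]
      exact ⟨Subalgebra.one_mem _, Subalgebra.zero_mem _⟩
    · rw [h.right_pivot]
      exact ⟨mem_adjoin_list (by simp), Subalgebra.one_mem _⟩
    · exact ⟨mem_adjoin_list (by simp), mem_adjoin_list (by simp)⟩
    · exact ⟨mem_adjoin_list (by simp), mem_adjoin_list (by simp)⟩

/-- If the product of the linear forms `x₁` and `x₂` restricted to the span of a reduced pair is
a multiple of the square of the second coordinate, then three generators suffice. -/
lemma IsReducedPair.exists_generators_of_tangent (h : IsReducedPair p v i j) (h0 : p 1 * p 2 = 0)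
    (h1 : p 1 * v 2 + p 2 * v 1 = 0) :
    ∃ l : List ℂ, l.length ≤ 3 ∧ ∀ r, p r ∈ Algebra.adjoin ℚ ((l.toFinset : Finset ℂ) : Set ℂ) ∧
      v r ∈ Algebra.adjoin ℚ ((l.toFinset : Finset ℂ) : Set ℂ) := by
  have hcases : (∃ s : Fin 4, p s.succ = 0 ∧ v s.succ = 0) ∨
      (p (Fin.succ 0) = 0 ∧ p (Fin.succ 1) = 0) := by
    change (∃ s : Fin 4, p s.succ = 0 ∧ v s.succ = 0) ∨ (p 1 = 0 ∧ p 2 = 0)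
    rcases mul_eq_zero.1 h0 with hp | hp
    · rcases mul_eq_zero.1 (show p 2 * v 1 = 0 by simpa [hp] using h1) with h2 | h2
      · exact Or.inr ⟨hp, h2⟩
      · exact Or.inl ⟨0, hp, h2⟩
    · rcases mul_eq_zero.1 (show p 1 * v 2 = 0 by simpa [hp] using h1) with h2 | h2
      · exact Or.inr ⟨h2, hp⟩
      · exact Or.inl ⟨1, hp, h2⟩
  rcases hcases with ⟨s, hps, hvs⟩ | ⟨hp0, hp1⟩
  · have hi : s ≠ i := by
      rintro rfl
      simp [h.left_pivot] at hps
    have hj : s ≠ j := by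
      rintro rfl
      simp [h.right_pivot] at hvs
    have hcover : ∀ s i j : Fin 4, i ≠ j → s ≠ i → s ≠ j →
        ∃ k, ∀ r, r = s ∨ r = i ∨ r = j ∨ r = k := by decide
    obtain ⟨k, hr⟩ := hcover s i j h.ne hi hj
    refine ⟨[p j.succ, p k.succ, v k.succ], by simp, fun r => ?_⟩
    refine Fin.cases ?_ (fun r => ?_) r
    · rw [h.left_zero, h.right_zero]
      exact ⟨Subalgebra.zero_mem _, Subalgebra.zero_mem _⟩
    · rcases hr r with rfl | rfl | rfl | rfl
      · rw [hps, hvs]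
        exact ⟨Subalgebra.zero_mem _, Subalgebra.zero_mem _⟩
      · rw [h.left_pivot, h.right_at_left_pivot]
        exact ⟨Subalgebra.one_mem _, Subalgebra.zero_mem _⟩
      · rw [h.right_pivot]
        exact ⟨mem_adjoin_list (by simp), Subalgebra.one_mem _⟩
      · exact ⟨mem_adjoin_list (by simp), mem_adjoin_list (by simp)⟩
  · have hi0 : i ≠ 0 := by
      rintro rfl
      exact one_ne_zero (h.left_pivot.symm.trans hp0)
    have hi1 : i ≠ 1 := by
      rintro rfl
      exact one_ne_zero (h.left_pivot.symm.trans hp1)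
    have hcover : ∀ i : Fin 4, i ≠ 0 → i ≠ 1 → ∃ k, ∀ r, r = 0 ∨ r = 1 ∨ r = i ∨ r = k := by
      decide
    have hcover' : ∀ i j : Fin 4, i ≠ j → ∃ k l, ∀ r, r = i ∨ r = j ∨ r = k ∨ r = l := by decide
    obtain ⟨k, hr⟩ := hcover i hi0 hi1
    obtain ⟨s, t, hr'⟩ := hcover' i j h.ne
    refine ⟨[p k.succ, v s.succ, v t.succ], by simp, fun r => ?_⟩
    refine Fin.cases ?_ (fun r => ⟨?_, ?_⟩) r
    · rw [h.left_zero, h.right_zero]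
      exact ⟨Subalgebra.zero_mem _, Subalgebra.zero_mem _⟩
    · rcases hr r with rfl | rfl | rfl | rfl
      · rw [hp0]
        exact Subalgebra.zero_mem _
      · rw [hp1]
        exact Subalgebra.zero_mem _
      · rw [h.left_pivot]
        exact Subalgebra.one_mem _
      · exact mem_adjoin_list (by simp)
    · rcases hr' r with rfl | rfl | rfl | rfl
      · rw [h.right_at_left_pivot]
        exact Subalgebra.zero_mem _
      · rw [h.right_pivot]
        exact Subalgebra.one_mem _
      · exact mem_adjoin_list (by simp)
      · exact mem_adjoin_list (by simp)

lemma IsReducedPair.nine_le_card (h : IsReducedPair p v i j) {c : (Fin 4 → ℕ) → ℂ}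
    (hc : AlgebraicIndependent ℚ c) {S : Finset ℂ}
    (hS : ∀ r, p r ∈ Algebra.adjoin ℚ (S : Set ℂ) ∧ v r ∈ Algebra.adjoin ℚ (S : Set ℂ))
    (hG : aeval (spanForms ![Pi.single 0 1, p, v]) (quartic c) ∈
      polynomialsOver (Fin 3) (S : Set ℂ)) : 9 ≤ S.card := by
  set A : Fin 3 → MvPolynomial (Fin 3) ℂ := ![X 0, X 1, X 2 - C (p j.succ) * X 1] with hA
  have hAmem : ∀ t, A t ∈ polynomialsOver (Fin 3) (S : Set ℂ) := by
    intro t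
    fin_cases t
    · exact X_mem_polynomialsOver 0
    · exact X_mem_polynomialsOver 1
    · exact Subring.sub_mem _ (X_mem_polynomialsOver 2)
        (Subring.mul_mem _ (C_mem_polynomialsOver (hS _).1) (X_mem_polynomialsOver 1))
  set ψ : Fin 5 → MvPolynomial (Fin 3) ℂ := fun r =>
    aeval A (spanForms ![Pi.single 0 1, p, v] r) with hψ
  have hψmem : ∀ r, ψ r ∈ polynomialsOver (Fin 3) (S : Set ℂ) := by
    intro r
    refine aeval_mem_polynomialsOver ?_ hAmem
    rw [spanForms, Fin.sum_univ_three]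
    refine linear_mem_polynomialsOver ?_ (hS r).1 (hS r).2
    change (Pi.single 0 1 : Fin 5 → ℂ) r ∈ _
    rcases eq_or_ne r 0 with rfl | hr
    · rw [Pi.single_eq_same]
      exact Subalgebra.one_mem _
    · rw [Pi.single_eq_of_ne hr]
      exact Subalgebra.zero_mem _
  have hψF : aeval ψ (quartic c) ∈ polynomialsOver (Fin 3) (S : Set ℂ) := by
    have := aeval_mem_polynomialsOver hG hAmem
    rwa [← AlgHom.comp_apply, comp_aeval] at this
  have hψ0 : ψ 0 = X 0 := by
    simp [hψ, spanForms, Fin.sum_univ_three, hA, h.left_zero, h.right_zero]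
  have hψi : ψ i.succ = X 1 := by
    simp [hψ, spanForms, Fin.sum_univ_three, hA, h.left_pivot, h.right_at_left_pivot]
  have hψj : ψ j.succ = X 2 := by
    simp [hψ, spanForms, Fin.sum_univ_three, hA, h.right_pivot]
  have hsupp : ∀ m : Fin 4 → ℕ, (∀ r, r = i ∨ r = j ∨ m r = 0) →
      ∀ f : Fin 4 → MvPolynomial (Fin 3) ℂ, ∏ r, f r ^ m r = f i ^ m i * f j ^ m j := by
    intro m hm f
    rw [← Finset.prod_subset (Finset.subset_univ {i, j}), Finset.prod_pair h.ne]
    intro r _ hr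
    simp only [Finset.mem_insert, Finset.mem_singleton, not_or] at hr
    rcases hm r with h1 | h1 | h1
    · exact absurd h1 hr.1
    · exact absurd h1 hr.2
    · rw [h1, pow_zero]
  have key := card_le_of_aeval_quartic_mem hc hψmem hψF
    (J := cubicQuarticExponents.filter (fun m => ∀ r, r = i ∨ r = j ∨ m r = 0))
    (e := fun m => Finsupp.equivFunOnFinite.symm ![4 - ∑ r, m r, m i, m j])
    (Finset.filter_subset _ _) ?_ ?_
  · have hJ : ∀ i j : Fin 4, i ≠ j → (cubicQuarticExponents.filter
        (fun m => ∀ r, r = i ∨ r = j ∨ m r = 0)).card = 9 := by decide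
    rwa [hJ i j h.ne] at key
  · intro m hm m' hm' hmm
    simp only [Finset.coe_filter, Set.mem_ofPred_eq] at hm hm'
    have h' := Finsupp.equivFunOnFinite.symm.injective hmm
    have hi : m i = m' i := congrFun h' 1
    have hj : m j = m' j := congrFun h' 2
    funext r
    rcases hm.2 r with rfl | rfl | h1
    · exact hi
    · exact hj
    · rcases hm'.2 r with rfl | rfl | h2
      · exact hi
      · exact hj
      · rw [h1, h2]
  · intro m hm
    rw [Finset.mem_filter] at hm
    rw [quarticMonomial, hsupp m hm.2 (fun r => ψ r.succ), hψ0, hψi, hψj, monomial_eq,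
      Finsupp.prod_fintype _ _ (by simp), Fin.prod_univ_three]
    simp [mul_assoc]

/-- A restriction of the quartic to the span of `(1, 0, 0, 0, 0)` and a reduced pair, as a
polynomial in the first variable. -/
lemma IsReducedPair.exists_eval_eq (h : IsReducedPair p v i j) (c : (Fin 4 → ℕ) → ℂ) (y z : ℂ) :
    ∃ A B : ℂ, ∀ x : ℂ,
      eval ![x, y, z] (aeval (spanForms ![Pi.single 0 1, p, v]) (quartic c)) =
        x ^ 2 * ((p 1 * y + v 1 * z) * (p 2 * y + v 2 * z)) + x * A + B := by
  refine ⟨eval (fun r : Fin 4 => p r.succ * y + v r.succ * z) (formOfCoeffs c 3),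
    eval (fun r : Fin 4 => p r.succ * y + v r.succ * z) (formOfCoeffs c 4), fun x => ?_⟩
  have hψ0 : eval ![x, y, z] (spanForms ![Pi.single 0 1, p, v] 0) = x := by
    simp [spanForms, Fin.sum_univ_three, h.left_zero, h.right_zero]
  have hψ : ∀ r : Fin 4, eval ![x, y, z] (spanForms ![Pi.single 0 1, p, v] r.succ) =
      p r.succ * y + v r.succ * z := by
    intro r
    simp [spanForms, Fin.sum_univ_three]
  have hcomp : ∀ q : MvPolynomial (Fin 4) ℂ, eval ![x, y, z]
      (aeval (spanForms ![Pi.single 0 1, p, v]) (rename Fin.succ q)) =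
      eval (fun r : Fin 4 => p r.succ * y + v r.succ * z) q := by
    intro q
    rw [aeval_rename, ← coe_aeval_eq_eval, RingHom.coe_coe, ← AlgHom.comp_apply, comp_aeval,
      ← coe_aeval_eq_eval, RingHom.coe_coe]
    congr 2
    funext r
    exact hψ r
  have h1 := hψ 0
  have h2 := hψ 1
  simp only [Fin.succ_zero_eq_one, Fin.succ_one_eq_two] at h1 h2
  simp only [quartic, map_add, map_mul, map_pow, aeval_X, hcomp, hψ0, h1, h2]
  ring

lemma coeff_eq_of_forall_quartic_eq {Q A B e4 e3 e2 e1 e0 : ℂ}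
    (h : ∀ x : ℂ, x ^ 2 * Q + x * A + B = e4 * x ^ 4 + e3 * x ^ 3 + e2 * x ^ 2 + e1 * x + e0) :
    e4 = 0 ∧ e3 = 0 ∧ Q = e2 := by
  have h0 := h 0
  have h1 := h 1
  have h2 := h (-1)
  have h3 := h 2
  have h4 := h (-2)
  have he4 : e4 = 0 := by
    linear_combination (-1 / 4) * h0 + (1 / 6) * (h1 + h2) - (1 / 24) * (h3 + h4)
  refine ⟨he4, ?_, ?_⟩
  · linear_combination (1 / 6) * (h1 - h2) - (1 / 12) * (h3 - h4)
  · linear_combination (1 / 2) * (h1 + h2) - h0 + he4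

/-- A product of two linear forms equal to a quadratic form. -/
lemma coeff_eq_of_forall_mul_eq {p₁ v₁ p₂ v₂ a b c : ℂ}
    (h : ∀ y z : ℂ, (p₁ * y + v₁ * z) * (p₂ * y + v₂ * z) = a * y ^ 2 + b * (y * z) + c * z ^ 2) :
    p₁ * p₂ = a ∧ p₁ * v₂ + p₂ * v₁ = b ∧ v₁ * v₂ = c := by
  have h1 := h 1 0
  have h2 := h 0 1
  have h3 := h 1 1
  refine ⟨?_, ?_, ?_⟩
  · linear_combination h1
  · linear_combination h3 - h1 - h2
  · linear_combination h2

lemma IsReducedPair.false_of_generators (h : IsReducedPair p v i j) {c : (Fin 4 → ℕ) → ℂ}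
    (hc : AlgebraicIndependent ℚ c) {l l' : List ℂ} (hl : l.length + l'.length ≤ 8)
    (hpv : ∀ r, p r ∈ Algebra.adjoin ℚ ((l.toFinset : Finset ℂ) : Set ℂ) ∧
      v r ∈ Algebra.adjoin ℚ ((l.toFinset : Finset ℂ) : Set ℂ))
    (hG : aeval (spanForms ![Pi.single 0 1, p, v]) (quartic c) ∈
      polynomialsOver (Fin 3) (((l ++ l').toFinset : Finset ℂ) : Set ℂ)) : False := by
  have hmono : ((l.toFinset : Finset ℂ) : Set ℂ) ⊆ ((l ++ l').toFinset : Finset ℂ) := by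
    simp
  have h9 := h.nine_le_card hc (S := (l ++ l').toFinset)
    (fun r => ⟨Algebra.adjoin_mono hmono (hpv r).1, Algebra.adjoin_mono hmono (hpv r).2⟩) hG
  have hcard := (l ++ l').toFinset_card_le
  rw [List.length_append] at hcard
  omega

lemma IsReducedPair.ne_linear_sq_mul (h : IsReducedPair p v i j) {c : (Fin 4 → ℕ) → ℂ}
    (hc : AlgebraicIndependent ℚ c) {g₀ g₁ g₂ h₀ h₁ h₂ h₃ h₄ h₅ : ℂ} (hg : g₀ ≠ 0 ∨ g₁ = 0) :
    aeval (spanForms ![Pi.single 0 1, p, v]) (quartic c) ≠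
      (C g₀ * X 0 + C g₁ * X 1 + C g₂ * X 2) ^ 2 *
        (C h₀ * X 0 ^ 2 + C h₁ * (X 0 * X 1) + C h₂ * (X 0 * X 2) + C h₃ * X 1 ^ 2 +
          C h₄ * (X 1 * X 2) + C h₅ * X 2 ^ 2) := by
  intro hG
  have hcoef : ∀ y z : ℂ, g₀ ^ 2 * h₀ = 0 ∧
      g₀ ^ 2 * (h₁ * y + h₂ * z) + 2 * g₀ * (g₁ * y + g₂ * z) * h₀ = 0 ∧
      (p 1 * y + v 1 * z) * (p 2 * y + v 2 * z) =
        g₀ ^ 2 * (h₃ * y ^ 2 + h₄ * (y * z) + h₅ * z ^ 2) +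
          2 * g₀ * (g₁ * y + g₂ * z) * (h₁ * y + h₂ * z) + (g₁ * y + g₂ * z) ^ 2 * h₀ := by
    intro y z
    obtain ⟨A, B, hAB⟩ := h.exists_eval_eq c y z
    refine coeff_eq_of_forall_quartic_eq (A := A) (B := B)
      (e1 := 2 * g₀ * (g₁ * y + g₂ * z) * (h₃ * y ^ 2 + h₄ * (y * z) + h₅ * z ^ 2) +
        (g₁ * y + g₂ * z) ^ 2 * (h₁ * y + h₂ * z))
      (e0 := (g₁ * y + g₂ * z) ^ 2 * (h₃ * y ^ 2 + h₄ * (y * z) + h₅ * z ^ 2)) fun x => ?_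
    rw [← hAB x, hG]
    simp
    ring
  by_cases hg0 : g₀ = 0
  · obtain rfl := hg0
    have hg1 : g₁ = 0 := by simpa using hg
    obtain rfl := hg1
    obtain ⟨e3, e4, e5⟩ := coeff_eq_of_forall_mul_eq (a := 0) (b := 0) (c := g₂ ^ 2 * h₀)
      fun y z => by rw [(hcoef y z).2.2]; ring
    obtain ⟨l, hl, hpv⟩ := h.exists_generators_of_tangent e3 e4
    set l' := [g₂ ^ 2 * h₁, g₂ ^ 2 * h₂, g₂ ^ 2 * h₃, g₂ ^ 2 * h₄, g₂ ^ 2 * h₅] with hl'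
    have hmono : ((l.toFinset : Finset ℂ) : Set ℂ) ⊆ ((l ++ l').toFinset : Finset ℂ) := by
      simp
    have hmem : ∀ x ∈ l', x ∈ Algebra.adjoin ℚ (((l ++ l').toFinset : Finset ℂ) : Set ℂ) :=
      fun x hx => mem_adjoin_list (List.mem_append_right l hx)
    refine h.false_of_generators hc (l' := l') (by simp [hl']; omega) hpv ?_
    have h0 : g₂ ^ 2 * h₀ ∈ Algebra.adjoin ℚ (((l ++ l').toFinset : Finset ℂ) : Set ℂ) := by
      rw [← e5]
      exact Subalgebra.mul_mem _ (Algebra.adjoin_mono hmono (hpv 1).2)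
        (Algebra.adjoin_mono hmono (hpv 2).2)
    have key := Subring.mul_mem _ (Subring.pow_mem _ (X_mem_polynomialsOver (2 : Fin 3)) 2)
      (quadratic_mem_polynomialsOver h0
        (hmem (g₂ ^ 2 * h₁) (by simp [hl'])) (hmem (g₂ ^ 2 * h₂) (by simp [hl']))
        (hmem (g₂ ^ 2 * h₃) (by simp [hl'])) (hmem (g₂ ^ 2 * h₄) (by simp [hl']))
        (hmem (g₂ ^ 2 * h₅) (by simp [hl'])))
    rw [hG]
    convert key using 1
    simp only [C_mul, C_pow, C_0]
    ring
  · have hh0 : h₀ = 0 := by simpa [hg0] using (hcoef 0 0).1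
    obtain rfl := hh0
    have hh1 : h₁ = 0 := by simpa [hg0] using (hcoef 1 0).2.1
    obtain rfl := hh1
    have hh2 : h₂ = 0 := by simpa [hg0] using (hcoef 0 1).2.1
    obtain rfl := hh2
    obtain ⟨e3, e4, e5⟩ := coeff_eq_of_forall_mul_eq (a := g₀ ^ 2 * h₃) (b := g₀ ^ 2 * h₄)
      (c := g₀ ^ 2 * h₅) fun y z => by rw [(hcoef y z).2.2]; ring
    obtain ⟨l, hl, hpv⟩ := h.exists_generators
    set l' := [g₁ / g₀, g₂ / g₀] with hl'
    have hmono : ((l.toFinset : Finset ℂ) : Set ℂ) ⊆ ((l ++ l').toFinset : Finset ℂ) := by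
      simp
    have hmem : ∀ x ∈ l', x ∈ Algebra.adjoin ℚ (((l ++ l').toFinset : Finset ℂ) : Set ℂ) :=
      fun x hx => mem_adjoin_list (List.mem_append_right l hx)
    have hp := fun r => Algebra.adjoin_mono hmono (hpv r).1
    have hv := fun r => Algebra.adjoin_mono hmono (hpv r).2
    refine h.false_of_generators hc (l' := l') (by simp [hl']; omega) hpv ?_
    have key := Subring.mul_mem _ (Subring.pow_mem _ (linear_mem_polynomialsOver
      (Subalgebra.one_mem _) (hmem (g₁ / g₀) (by simp [hl']))
      (hmem (g₂ / g₀) (by simp [hl']))) 2)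
      (quadratic_mem_polynomialsOver (Subalgebra.zero_mem _) (Subalgebra.zero_mem _)
        (Subalgebra.zero_mem _) (Subalgebra.mul_mem _ (hp 1) (hp 2))
        (Subalgebra.add_mem _ (Subalgebra.mul_mem _ (hp 1) (hv 2))
          (Subalgebra.mul_mem _ (hp 2) (hv 1))) (Subalgebra.mul_mem _ (hv 1) (hv 2)))
    rw [e3, e4, e5] at key
    rw [hG]
    convert key using 1
    have hb : (C g₁ : MvPolynomial (Fin 3) ℂ) = C g₀ * C (g₁ / g₀) := by
      rw [← C_mul, mul_div_cancel₀ _ hg0]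
    have hc' : (C g₂ : MvPolynomial (Fin 3) ℂ) = C g₀ * C (g₂ / g₀) := by
      rw [← C_mul, mul_div_cancel₀ _ hg0]
    rw [hb, hc']
    simp only [C_mul, C_pow, C_0, C_1]
    ring

lemma IsReducedPair.ne_quadratic_sq_mul (h : IsReducedPair p v i j) {c : (Fin 4 → ℕ) → ℂ}
    (hc : AlgebraicIndependent ℚ c) {g₀ g₁ g₂ g₃ g₄ g₅ s : ℂ} (hg : g₀ ≠ 0 ∨ g₁ = 0) :
    aeval (spanForms ![Pi.single 0 1, p, v]) (quartic c) ≠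
      (C g₀ * X 0 ^ 2 + C g₁ * (X 0 * X 1) + C g₂ * (X 0 * X 2) + C g₃ * X 1 ^ 2 +
          C g₄ * (X 1 * X 2) + C g₅ * X 2 ^ 2) ^ 2 * C s := by
  intro hG
  have hcoef : ∀ y z : ℂ, g₀ ^ 2 * s = 0 ∧ 2 * g₀ * (g₁ * y + g₂ * z) * s = 0 ∧
      (p 1 * y + v 1 * z) * (p 2 * y + v 2 * z) =
        ((g₁ * y + g₂ * z) ^ 2 + 2 * g₀ * (g₃ * y ^ 2 + g₄ * (y * z) + g₅ * z ^ 2)) * s := by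
    intro y z
    obtain ⟨A, B, hAB⟩ := h.exists_eval_eq c y z
    refine coeff_eq_of_forall_quartic_eq (A := A) (B := B)
      (e1 := 2 * (g₁ * y + g₂ * z) * (g₃ * y ^ 2 + g₄ * (y * z) + g₅ * z ^ 2) * s)
      (e0 := (g₃ * y ^ 2 + g₄ * (y * z) + g₅ * z ^ 2) ^ 2 * s) fun x => ?_
    rw [← hAB x, hG]
    simp
    ring
  by_cases hs : s = 0
  · obtain ⟨l, hl, hpv⟩ := h.exists_generators
    refine h.false_of_generators hc (l' := []) (by simp; omega) hpv ?_
    rw [hG, hs, C_0, mul_zero]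
    exact Subring.zero_mem _
  · have hg0 : g₀ = 0 := by simpa [hs] using (hcoef 0 0).1
    obtain rfl := hg0
    have hg1 : g₁ = 0 := by simpa using hg
    obtain rfl := hg1
    obtain ⟨e1, e2, -⟩ := coeff_eq_of_forall_mul_eq (a := 0) (b := 0) (c := g₂ ^ 2 * s)
      fun y z => by rw [(hcoef y z).2.2]; ring
    obtain ⟨l, hl, hpv⟩ := h.exists_generators_of_tangent e1 e2
    set l' := [g₂, g₃, g₄, g₅, s] with hl'
    have hmem : ∀ x ∈ l', x ∈ Algebra.adjoin ℚ (((l ++ l').toFinset : Finset ℂ) : Set ℂ) :=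
      fun x hx => mem_adjoin_list (List.mem_append_right l hx)
    refine h.false_of_generators hc (l' := l') (by simp [hl']; omega) hpv ?_
    rw [hG]
    exact Subring.mul_mem _ (Subring.pow_mem _ (quadratic_mem_polynomialsOver
      (Subalgebra.zero_mem _) (Subalgebra.zero_mem _) (hmem g₂ (by simp [hl']))
      (hmem g₃ (by simp [hl'])) (hmem g₄ (by simp [hl'])) (hmem g₅ (by simp [hl']))) 2)
      (C_mem_polynomialsOver (hmem s (by simp [hl'])))

lemma exists_isReducedPair {φ : (Fin 3 → ℂ) →ₗ[ℂ] (Fin 5 → ℂ)} (hφ : Function.Injective φ)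
    {k : Fin 3 → ℂ} (hk : φ k = Pi.single 0 1) (ℓ : (Fin 3 → ℂ) →ₗ[ℂ] ℂ) :
    ∃ p v i j, IsReducedPair (φ p) (φ v) i j ∧ (ℓ k ≠ 0 ∨ ℓ p = 0) := by
  have hpivot : ∀ w : Fin 3 → ℂ, w ≠ 0 → φ w 0 = 0 → ∃ i : Fin 4, φ w i.succ ≠ 0 := by
    intro w hw hw0
    by_contra! hcon
    apply hw
    apply hφ
    rw [map_zero]
    funext r
    exact Fin.cases hw0 hcon r
  have hspan1 : Submodule.span ℂ {k} ≠ ⊤ := by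
    intro htop
    have := finrank_span_le_card (R := ℂ) ({k} : Set (Fin 3 → ℂ))
    rw [htop, finrank_top] at this
    simp at this
  have hp : ∃ p₀ : Fin 3 → ℂ, p₀ ∉ Submodule.span ℂ {k} ∧ (ℓ k ≠ 0 ∨ ℓ p₀ = 0) := by
    by_cases hℓ : ℓ k = 0
    · have hker : ¬ LinearMap.ker ℓ ≤ Submodule.span ℂ {k} := by
        intro hle
        have h1 := Submodule.finrank_mono hle
        have h2 := finrank_span_le_card (R := ℂ) ({k} : Set (Fin 3 → ℂ))
        have h3 := LinearMap.finrank_range_add_finrank_ker ℓ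
        have h4 := Submodule.finrank_le (LinearMap.range ℓ)
        simp at h2 h3 h4
        omega
      obtain ⟨p₀, hp₀, hnot⟩ := SetLike.not_le_iff_exists.1 hker
      exact ⟨p₀, hnot, Or.inr hp₀⟩
    · obtain ⟨p₀, hp₀⟩ := SetLike.exists_not_mem_of_ne_top _ hspan1 rfl
      exact ⟨p₀, hp₀, Or.inl hℓ⟩
  obtain ⟨p₀, hp₀, hℓp₀⟩ := hp
  set p₁ := p₀ - φ p₀ 0 • k with hp₁
  have hp₁0 : φ p₁ 0 = 0 := by simp [hp₁, hk]
  have hp₁ne : p₁ ≠ 0 := by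
    intro h0
    apply hp₀
    have h1 : p₀ = φ p₀ 0 • k := sub_eq_zero.1 h0
    rw [h1]
    exact Submodule.smul_mem _ _ (Submodule.mem_span_singleton_self k)
  obtain ⟨i, hi⟩ := hpivot p₁ hp₁ne hp₁0
  have hspan2 : Submodule.span ℂ (Set.range ![k, p₁]) ≠ ⊤ := by
    intro htop
    have h1 := finrank_range_le_card (R := ℂ) ![k, p₁]
    rw [Set.finrank, htop, finrank_top] at h1
    simp at h1
  obtain ⟨v₀, hv₀⟩ := SetLike.exists_not_mem_of_ne_top _ hspan2 rfl
  set p := (φ p₁ i.succ)⁻¹ • p₁ with hpdef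
  have hpi : φ p i.succ = 1 := by simp [hpdef, hi]
  have hp0 : φ p 0 = 0 := by simp [hpdef, hp₁0]
  set v₁ := v₀ - φ v₀ 0 • k - φ v₀ i.succ • p with hv₁
  have hv₁0 : φ v₁ 0 = 0 := by simp [hv₁, hk, hp0]
  have hv₁i : φ v₁ i.succ = 0 := by simp [hv₁, hk, hpi]
  have hv₁ne : v₁ ≠ 0 := by
    intro h0
    apply hv₀
    have h1 : v₀ = φ v₀ 0 • k + (φ v₀ i.succ * (φ p₁ i.succ)⁻¹) • p₁ := by
      rw [mul_smul, ← hpdef]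
      rwa [hv₁, sub_sub, sub_eq_zero] at h0
    rw [h1]
    exact Submodule.add_mem _ (Submodule.smul_mem _ _ (Submodule.subset_span ⟨0, rfl⟩))
      (Submodule.smul_mem _ _ (Submodule.subset_span ⟨1, rfl⟩))
  obtain ⟨j, hj⟩ := hpivot v₁ hv₁ne hv₁0
  refine ⟨p, (φ v₁ j.succ)⁻¹ • v₁, i, j, ⟨?_, hp0, by simp [hv₁0], hpi, by simp [hv₁i],
    by simp [hj]⟩, ?_⟩
  · rintro rfl
    exact hj hv₁i
  · by_cases hℓ : ℓ k = 0
    · right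
      have : ℓ p₀ = 0 := hℓp₀.resolve_left (not_not.2 hℓ)
      simp [hpdef, hp₁, this, hℓ]
    · exact Or.inl hℓ

lemma eval_aeval_spanForms (k p v : Fin 3 → ℂ) (g : MvPolynomial (Fin 3) ℂ) (x y z : ℂ) :
    eval ![x, y, z] (aeval (spanForms ![k, p, v]) g) = eval (x • k + y • p + z • v) g := by
  rw [← coe_aeval_eq_eval, RingHom.coe_coe, ← AlgHom.comp_apply, comp_aeval,
    ← coe_aeval_eq_eval, RingHom.coe_coe]
  congr 2
  funext r
  simp [spanForms, Fin.sum_univ_three, mul_comm]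

lemma not_hasSquareFactor_of_mem_range {c : (Fin 4 → ℕ) → ℂ} (hc : AlgebraicIndependent ℚ c)
    {φ : (Fin 3 → ℂ) →ₗ[ℂ] (Fin 5 → ℂ)} (hφ : Function.Injective φ) {k : Fin 3 → ℂ}
    (hk : φ k = Pi.single 0 1) :
    ¬ HasSquareFactor (aeval (spanForms (fun j => φ (Pi.single j 1))) (quartic c)) := by
  rintro ⟨g, h, hG, hgh⟩
  have hrestrict : ∀ p v : Fin 3 → ℂ,
      aeval (spanForms ![Pi.single 0 1, φ p, φ v]) (quartic c) =
        aeval (spanForms ![k, p, v]) g ^ 2 * aeval (spanForms ![k, p, v]) h := by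
    intro p v
    have h1 := aeval_spanForms_quartic (c := c) φ ![k, p, v]
    have h2 : (fun t => φ (![k, p, v] t)) = ![Pi.single 0 1, φ p, φ v] := by
      funext t
      fin_cases t <;> simp [hk]
    rw [hG, h2, map_mul, map_pow] at h1
    exact h1.symm
  have hhom : ∀ (p v : Fin 3 → ℂ) {q : MvPolynomial (Fin 3) ℂ} {d : ℕ}, q.IsHomogeneous d →
      (aeval (spanForms ![k, p, v]) q).IsHomogeneous d := by
    intro p v q d hq
    simpa using hq.aeval _ (spanForms_isHomogeneous ![k, p, v])
  rcases hgh with ⟨hg, hh⟩ | ⟨hg, hh⟩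
  · obtain ⟨a, b, d, hgeq⟩ := IsHomogeneous.exists_linear hg
    obtain ⟨p, v, i, j, hpv, hℓ⟩ := exists_isReducedPair hφ hk
      (a • LinearMap.proj 0 + b • LinearMap.proj 1 + d • LinearMap.proj 2)
    obtain ⟨g₀, g₁, g₂, hg'⟩ := IsHomogeneous.exists_linear (hhom p v hg)
    obtain ⟨h₀, h₁, h₂, h₃, h₄, h₅, hh'⟩ := IsHomogeneous.exists_quadratic (hhom p v hh)
    have heval := eval_aeval_spanForms k p v g
    rw [hg', hgeq] at heval
    have e0 := heval 1 0 0
    have e1 := heval 0 1 0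
    simp at e0 e1 hℓ
    have hres := hrestrict p v
    rw [hg', hh'] at hres
    refine hpv.ne_linear_sq_mul hc ?_ hres
    rw [e0, e1]
    exact hℓ
  · obtain ⟨a, b, d, e, f, m, hgeq⟩ := IsHomogeneous.exists_quadratic hg
    obtain ⟨p, v, i, j, hpv, hℓ⟩ := exists_isReducedPair hφ hk
      ((2 * a * k 0 + b * k 1 + d * k 2) • LinearMap.proj 0 +
        (b * k 0 + 2 * e * k 1 + f * k 2) • LinearMap.proj 1 +
        (d * k 0 + f * k 1 + 2 * m * k 2) • LinearMap.proj 2)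
    obtain ⟨g₀, g₁, g₂, g₃, g₄, g₅, hg'⟩ := IsHomogeneous.exists_quadratic (hhom p v hg)
    obtain ⟨s, hh'⟩ := IsHomogeneous.exists_const (hhom p v hh)
    have heval := eval_aeval_spanForms k p v g
    rw [hg', hgeq] at heval
    have e0 := heval 1 0 0
    have e1 := heval 0 1 0
    have e2 := heval 1 1 0
    simp at e0 e1 e2 hℓ
    have hres := hrestrict p v
    rw [hg', hh'] at hres
    refine hpv.ne_quadratic_sq_mul hc ?_ hres
    rcases hℓ with hne | h0
    · refine Or.inl fun h0 => hne ?_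
      rw [h0] at e0
      linear_combination (-2) * e0
    · refine Or.inr ?_
      linear_combination e2 - e0 - e1 + h0

lemma not_hasSquareFactor {c : (Fin 4 → ℕ) → ℂ} (hc : AlgebraicIndependent ℚ c)
    {φ : (Fin 3 → ℂ) →ₗ[ℂ] (Fin 5 → ℂ)} (hφ : Function.Injective φ) :
    ¬ HasSquareFactor (aeval (spanForms (fun j => φ (Pi.single j 1))) (quartic c)) := by
  by_cases hinj : Function.Injective (LinearMap.funLeft ℂ ℂ (Fin.succ : Fin 4 → Fin 5) ∘ₗ φ)
  · exact not_hasSquareFactor_of_notMem_range hc hinj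
  · rw [← LinearMap.ker_eq_bot, Submodule.eq_bot_iff] at hinj
    push Not at hinj
    obtain ⟨u, hu, hu0⟩ := hinj
    have hzero : ∀ s : Fin 4, φ u s.succ = 0 := fun s => congrFun (LinearMap.mem_ker.1 hu) s
    have hne : φ u 0 ≠ 0 := by
      intro h0
      apply hu0
      apply hφ
      rw [map_zero]
      funext r
      exact Fin.cases h0 hzero r
    refine not_hasSquareFactor_of_mem_range hc hφ (k := (φ u 0)⁻¹ • u) ?_
    funext r
    refine Fin.cases ?_ (fun s => ?_) r
    · simp [hne]
    · simp [hzero]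

end PlanesThroughPoint

/-- There exist homogeneous polynomials `a₃` of degree 3 and
`b₄` of degree 4 in `ℂ[x₁,…,x₄]` such that for every injective linear map
`φ : ℂ³ → ℂ⁵`, the quartic in `ℂ[u,v,w]` obtained by composing
`F = x₀²x₁x₂ + x₀a₃ + b₄` with `φ` is nonzero and squarefree; i.e., every plane
section of the quartic 3-fold `X = {F = 0} ⊂ ℙ⁴` is a reduced curve. -/
theorem every_plane_section_reduced :
    ∃ a₃ b₄ : MvPolynomial (Fin 4) ℂ,
      a₃.IsHomogeneous 3 ∧ b₄.IsHomogeneous 4 ∧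
      ∀ φ : (Fin 3 → ℂ) →ₗ[ℂ] (Fin 5 → ℂ), Function.Injective φ →
        (aeval (fun i : Fin 5 => ∑ j : Fin 3, C (φ (Pi.single j 1) i) * X j)
            (X 0 ^ 2 * X 1 * X 2 + X 0 * rename Fin.succ a₃ + rename Fin.succ b₄
              : MvPolynomial (Fin 5) ℂ) ≠ 0) ∧
        Squarefree
          (aeval (fun i : Fin 5 => ∑ j : Fin 3, C (φ (Pi.single j 1) i) * X j)
            (X 0 ^ 2 * X 1 * X 2 + X 0 * rename Fin.succ a₃ + rename Fin.succ b₄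
              : MvPolynomial (Fin 5) ℂ)) := by
  obtain ⟨c, hc⟩ := exists_algebraicIndependent_complex (Fin 4 → ℕ)
  refine ⟨formOfCoeffs c 3, formOfCoeffs c 4, formOfCoeffs_isHomogeneous c 3,
    formOfCoeffs_isHomogeneous c 4, fun φ hφ => ?_⟩
  change aeval (spanForms (fun j => φ (Pi.single j 1))) (quartic c) ≠ 0 ∧
    Squarefree (aeval (spanForms (fun j => φ (Pi.single j 1))) (quartic c))
  have hhom : (aeval (spanForms (fun j => φ (Pi.single j 1))) (quartic c)).IsHomogeneous 4 := by
    simpa using (quartic_isHomogeneous c).aeval _ (spanForms_isHomogeneous _)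
  have hsq : Squarefree (aeval (spanForms (fun j => φ (Pi.single j 1))) (quartic c)) := by
    by_contra hcon
    exact not_hasSquareFactor hc hφ (hasSquareFactor_of_not_squarefree hhom hcon)
  exact ⟨hsq.ne_zero, hsq⟩
end
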